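/- arXiv:1307.6901 — 5 statements merged into one kernel-verified Lean document; each statement's English description precedes it below -/
import Mathlib

section
/- Let Beh be a type, ν a set of Boolean-valued functions on Beh, and vtt ⊆ Beh with vff = Beh \ vtt. If ν is adequate for (vtt, vff), then the formula F constructed as the disjunction of the valuation formulas of all valuations whose class is contained in vtt is accurate: {β : Beh | ∃ V : ν → Bool, ⟦V⟧_ν ⊆ vtt ∧ β ∈ ⟦V⟧_ν} = vtt. -/
/-- The class `⟦V⟧_F` of a valuation `V : F → Bool`: behaviors agreeing with `V` on all of `F`. -/
def klass {Beh : Type*} (F : Set (Beh → Bool)) (V : F → Bool) : Set Beh :=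
  {β : Beh | ∀ f : F, (f : Beh → Bool) β = V f}

/-- Correctness of ConstructFormula. -/
theorem constructFormula_accurate (Beh : Type*) (ν : Set (Beh → Bool)) (vtt : Set Beh)
    (adequate : ∀ V : ν → Bool, klass ν V ⊆ vtt ∨ klass ν V ⊆ vttᶜ) :
    {β : Beh | ∃ V : ν → Bool, klass ν V ⊆ vtt ∧ β ∈ klass ν V} = vtt := by
  ext β
  constructor
  · rintro ⟨V, hV, hβ⟩
    exact hV hβ
  · intro hβ
    have hmem : β ∈ klass ν (fun f => (f : Beh → Bool) β) := fun _ => rfl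
    exact ⟨_, (adequate _).resolve_right fun h => h hmem hβ, hmem⟩
end

section
/- Let Beh be a type, ν a set of Boolean-valued functions on Beh, and vtt ⊆ Beh. Suppose G : Beh → Prop is ν-invariant (for all β, β' : Beh, if g β = g β' for every g ∈ ν, then G β ↔ G β') and accurate for vtt (i.e., {β : Beh | G β} = vtt). Then ν is adequate for (vtt, Beh \ vtt): for every valuation V : ν → Bool, either ⟦V⟧_ν ⊆ vtt or ⟦V⟧_ν ⊆ Beh \ vtt. -/
/-- If a ν-invariant predicate `G` is accurate for `vtt`, then ν is adequate. -/
theorem adequacy_necessary (Beh : Type*) (ν : Set (Beh → Bool)) (vtt : Set Beh)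
    (G : Beh → Prop)
    (hinv : ∀ β β' : Beh, (∀ g ∈ ν, g β = g β') → (G β ↔ G β'))
    (hacc : {β : Beh | G β} = vtt) :
    ∀ V : ν → Bool, klass ν V ⊆ vtt ∨ klass ν V ⊆ vttᶜ := by
  subst hacc
  intro V
  by_cases h : ∃ β ∈ klass ν V, G β
  · obtain ⟨β, hβ, hG⟩ := h
    exact Or.inl fun β' hβ' =>
      (hinv β β' fun g hg => (hβ ⟨g, hg⟩).trans (hβ' ⟨g, hg⟩).symm).mp hG
  · exact Or.inr fun β hβ hG => h ⟨β, hβ, hG⟩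
end

section
/- Let Beh be a type and let (good, bad, dc) be a partition of Beh (the three sets are pairwise disjoint and their union is Beh). Let P, Q : Beh → Prop be such that {β : Beh | P β} = good ∪ bad, and suppose there is a partition (φ, ψ) of dc (φ ∪ ψ = dc, φ ∩ ψ = ∅) with {β : Beh | Q β} = good ∪ φ. Then the specification S = (P, Q) is accurate with respect to (good, bad, dc): {β : Beh | P β → Q β} = good ∪ dc. -/
/-- Reduction of specification construction to formula construction. -/
theorem spec_reduction (Beh : Type*) (good bad dc : Set Beh)
    (hgb : Disjoint good bad) (hgd : Disjoint good dc) (hbd : Disjoint bad dc)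
    (hcover : good ∪ bad ∪ dc = Set.univ)
    (P Q : Beh → Prop)
    (hP : {β : Beh | P β} = good ∪ bad)
    (hQ : ∃ φ ψ : Set Beh, φ ∪ ψ = dc ∧ φ ∩ ψ = ∅ ∧ {β : Beh | Q β} = good ∪ φ) :
    {β : Beh | P β → Q β} = good ∪ dc := by
  obtain ⟨φ, ψ, rfl, -, hQ⟩ := hQ
  ext β
  have hPβ : P β ↔ β ∈ good ∨ β ∈ bad := Set.ext_iff.mp hP β
  have hQβ : Q β ↔ β ∈ good ∨ β ∈ φ := Set.ext_iff.mp hQ β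
  have hβ : (β ∈ good ∨ β ∈ bad) ∨ β ∈ φ ∨ β ∈ ψ := Set.ext_iff.mp hcover β |>.mpr trivial
  have hbd' : β ∈ bad → ¬(β ∈ φ ∨ β ∈ ψ) := fun h => Set.disjoint_left.mp hbd h
  change (P β → Q β) ↔ β ∈ good ∨ β ∈ φ ∨ β ∈ ψ
  tauto
end

section
/- Let Beh be a type, ε and ν sets of Boolean-valued functions on Beh, and vtt ⊆ Beh with vff = Beh \ vtt. Assume (Axiom-E) any two ε-equivalent behaviors lie on the same side of the partition: for all β, β', if f β = f β' for every f ∈ ε, then (β ∈ vtt ↔ β' ∈ vtt). Assume also that every g ∈ ν is ε-invariant: for all β, β', if f β = f β' for every f ∈ ε then g β = g β'. For a valuation V : ν → Bool, define the correction predicate c_V : Beh → Prop by c_V β := ∃ W : ε → Bool, ⟦W⟧_ε ⊆ ⟦V⟧_ν ∧ ⟦W⟧_ε ⊆ vtt ∧ β ∈ ⟦W⟧_ε. Then for every β ∈ ⟦V⟧_ν, c_V β ↔ β ∈ vtt; hence c_V splits the class ⟦V⟧_ν exactly into ⟦V⟧_ν ∩ vtt and ⟦V⟧_ν ∩ vff.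 -/
/-- The correction predicate `c_V` for a valuation `V : ν → Bool`. -/
def corr {Beh : Type*} (ε ν : Set (Beh → Bool)) (vtt : Set Beh) (V : ν → Bool)
    (β : Beh) : Prop :=
  ∃ W : ε → Bool, klass ε W ⊆ klass ν V ∧ klass ε W ⊆ vtt ∧ β ∈ klass ε W

/-- Splitting property of the correction formulae of MakeAdequate. -/
theorem correction_splits (Beh : Type*) (ε ν : Set (Beh → Bool)) (vtt : Set Beh)
    (axE : ∀ β β' : Beh, (∀ f ∈ ε, f β = f β') → (β ∈ vtt ↔ β' ∈ vtt))
    (hinv : ∀ g ∈ ν, ∀ β β' : Beh, (∀ f ∈ ε, f β = f β') → g β = g β')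
    (V : ν → Bool) :
    (∀ β ∈ klass ν V, (corr ε ν vtt V β ↔ β ∈ vtt)) ∧
    {β : Beh | β ∈ klass ν V ∧ corr ε ν vtt V β} = klass ν V ∩ vtt ∧
    {β : Beh | β ∈ klass ν V ∧ ¬ corr ε ν vtt V β} = klass ν V ∩ vttᶜ := by
  have key : ∀ β ∈ klass ν V, (corr ε ν vtt V β ↔ β ∈ vtt) := by
    intro β hβ
    constructor
    · rintro ⟨W, -, hW, hβW⟩
      exact hW hβW
    · intro hv
      refine ⟨fun f => (f : Beh → Bool) β, fun β' h => ?_, fun β' h => ?_, fun f => rfl⟩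
      · intro g
        rw [hinv g g.2 β' β fun f hf => h ⟨f, hf⟩]
        exact hβ g
      · exact (axE β' β fun f hf => h ⟨f, hf⟩).2 hv
  refine ⟨key, ?_, ?_⟩
  · ext β
    exact and_congr_right (key β)
  · ext β
    exact and_congr_right fun hβ => not_congr (key β hβ)
end

section
/- Let Beh be a type, ε and ν sets of Boolean-valued functions on Beh, and vtt ⊆ Beh with vff = Beh \ vtt. Assume (Axiom-E) any two ε-equivalent behaviors lie on the same side of the partition: for all β, β', if f β = f β' for every f ∈ ε, then (β ∈ vtt ↔ β' ∈ vtt). Assume also that every g ∈ ν is ε-invariant: for all β, β', if f β = f β' for every f ∈ ε then g β = g β'. For each valuation V : ν → Bool, define the correction predicate c_V : Beh → Prop by c_V β := ∃ W : ε → Bool, ⟦W⟧_ε ⊆ ⟦V⟧_ν ∧ ⟦W⟧_ε ⊆ vtt ∧ β ∈ ⟦W⟧_ε. Then the augmented vocabulary consisting of ν together with all correction predicates c_V is adequate for (vtt, vff): for all β, β', if g β = g β' for all g ∈ ν and c_V β ↔ c_V β' for all valuations V : ν → Bool, then β ∈ vtt ↔ β' ∈ vtt; equivalently, every equivalence class of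 the augmented vocabulary is contained in vtt or in vff. -/
/-- A correction predicate only holds on the positive side of the partition. -/
theorem mem_of_corr {Beh : Type*} {ε ν : Set (Beh → Bool)} {vtt : Set Beh} {V : ν → Bool}
    {β : Beh} (h : corr ε ν vtt V β) : β ∈ vtt :=
  let ⟨_, _, hsub, hβ⟩ := h
  hsub hβ

/-- A positive behavior satisfies the correction predicate of the valuation it induces. -/
theorem corr_of_mem {Beh : Type*} {ε ν : Set (Beh → Bool)} {vtt : Set Beh}
    (axE : ∀ β β' : Beh, (∀ f ∈ ε, f β = f β') → (β ∈ vtt ↔ β' ∈ vtt))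
    (hinv : ∀ g ∈ ν, ∀ β β' : Beh, (∀ f ∈ ε, f β = f β') → g β = g β')
    {β : Beh} (hβ : β ∈ vtt) : corr ε ν vtt (fun g => g.1 β) β :=
  ⟨fun f => f.1 β,
    fun γ hγ g => hinv g.1 g.2 γ β fun f hf => hγ ⟨f, hf⟩,
    fun γ hγ => (axE γ β fun f hf => hγ ⟨f, hf⟩).2 hβ,
    fun _ => rfl⟩

/-- Correctness of MakeAdequate — the augmented vocabulary is adequate. -/
theorem makeAdequate_correct (Beh : Type*) (ε ν : Set (Beh → Bool)) (vtt : Set Beh)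
    (axE : ∀ β β' : Beh, (∀ f ∈ ε, f β = f β') → (β ∈ vtt ↔ β' ∈ vtt))
    (hinv : ∀ g ∈ ν, ∀ β β' : Beh, (∀ f ∈ ε, f β = f β') → g β = g β') :
    ∀ β β' : Beh,
      (∀ g ∈ ν, g β = g β') →
      (∀ V : ν → Bool, corr ε ν vtt V β ↔ corr ε ν vtt V β') →
      (β ∈ vtt ↔ β' ∈ vtt) := by
  intro β β' _ hcorr
  exact ⟨fun h => mem_of_corr ((hcorr _).1 (corr_of_mem axE hinv h)),
    fun h => mem_of_corr ((hcorr _).2 (corr_of_mem axE hinv h))⟩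
end
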